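/- Let X_n be the structured matrix over ℝ[x_1,…,x_n], t_k(n) = (1/n) trace(X_n^k), and T_m(n) the m×m matrix with first column (t_1(n),…,t_m(n))^T, superdiagonal 1,…,m-1, entries t_{i-j+1}(n) for j ≤ i, and zeros elsewhere. Then (-1)^{m-1} det(T_m(n)) is a polynomial in x_1,…,x_n with nonnegative coefficients, for all positive integers m and n. -/

import Mathlib

open Matrix Polynomial PowerSeries

/-- The structured matrix `X_n`: first column `(x_1,…,x_n)ᵀ`, superdiagonal `1,…,n-1`,
entry `x_{i-j+1}` for `j ≤ i` (1-based), zeros elsewhere. -/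
def Xmat (R : Type*) [CommRing R] (n : ℕ) (x : ℕ → R) : Matrix (Fin n) (Fin n) R :=
  fun i j =>
    if (j : ℕ) ≤ (i : ℕ) then x ((i : ℕ) - (j : ℕ) + 1)
    else if (j : ℕ) = (i : ℕ) + 1 then (((i : ℕ) + 1 : ℕ) : R)
    else 0

section NonnegSeries

variable {R : Type*} [CommRing R]

/-- The subsemiring of power series all of whose coefficients lie in a subsemiring `S`. -/
def Subsemiring.powerSeries (S : Subsemiring R) : Subsemiring (PowerSeries R) where
  carrier := {f | ∀ n, PowerSeries.coeff n f ∈ S}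
  mul_mem' {f g} hf hg n := by
    rw [PowerSeries.coeff_mul]
    exact sum_mem fun p _ => mul_mem (hf p.1) (hg p.2)
  one_mem' n := by
    rw [PowerSeries.coeff_one]
    split_ifs <;> simp
  add_mem' hf hg n := by
    rw [map_add]
    exact add_mem (hf n) (hg n)
  zero_mem' n := by simp

theorem Subsemiring.invOfUnit_mem_powerSeries {S : Subsemiring R} {f : PowerSeries R}
    (h1 : PowerSeries.constantCoeff f = 1) (hf : 1 - f ∈ S.powerSeries) :
    PowerSeries.invOfUnit f 1 ∈ S.powerSeries := by
  set g := PowerSeries.invOfUnit f 1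
  have hg : g = 1 + (1 - f) * g := by
    have : f * g = 1 := PowerSeries.mul_invOfUnit f 1 (by simpa using h1)
    linear_combination this
  intro n
  induction n using Nat.strong_induction_on with
  | _ n ih =>
    rw [hg, map_add, PowerSeries.coeff_mul]
    refine add_mem (one_mem S.powerSeries n) (sum_mem fun p hp => ?_)
    rw [Finset.HasAntidiagonal.mem_antidiagonal] at hp
    rcases Nat.eq_zero_or_pos p.1 with h0 | h0
    · simp [h0, h1]
    · exact mul_mem (hf _) (ih _ (by omega))

theorem Subsemiring.subst_mem_powerSeries [Algebra ℝ R] {S : Subsemiring R}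
    (hS : ∀ c : ℝ, 0 ≤ c → ∀ s ∈ S, c • s ∈ S) {h : PowerSeries ℝ}
    (hh : ∀ n, 0 ≤ PowerSeries.coeff n h) {f : PowerSeries R}
    (h0 : PowerSeries.constantCoeff f = 0) (hf : f ∈ S.powerSeries) :
    h.subst f ∈ S.powerSeries := by
  intro n
  rw [PowerSeries.coeff_subst' (PowerSeries.HasSubst.of_constantCoeff_zero' h0)]
  exact finsum_induction (· ∈ S) (zero_mem S) (fun _ _ => add_mem)
    fun d => hS _ (hh d) _ (pow_mem hf d n)

/-- The series `(1 - (1 - X) ^ a) / X` has nonnegative coefficients for `a = k / (k + 1)`. -/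
theorem exists_one_sub_X_mul_pow_eq (k : ℕ) :
    ∃ h : PowerSeries ℝ, (∀ n, 0 ≤ PowerSeries.coeff n h) ∧
      (1 - PowerSeries.X * h) ^ (k + 1) = (1 - PowerSeries.X) ^ k := by
  set a : ℝ := k / (k + 1)
  have ha0 : 0 ≤ a := by positivity
  have ha1 : a ≤ 1 := by
    rw [div_le_one (by positivity)]
    linarith
  set c : ℕ → ℝ := fun n => (-1) ^ n * Ring.choose a n
  have hrec (n : ℕ) : ((n : ℝ) + 1) * c (n + 1) = (n - a) * c n := by
    have := Ring.choose_smul_choose a (n := n + 1) (k := n) (by omega)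
    rw [Nat.choose_succ_self_right, Nat.add_sub_cancel_left, Ring.choose_one_right,
      nsmul_eq_mul] at this
    push_cast at this
    simp only [c]
    linear_combination (-1) ^ (n + 1) * this
  have hc (n : ℕ) : c (n + 1) ≤ 0 := by
    induction n with
    | zero => simpa [c, Ring.choose_one_right] using ha0
    | succ n ih =>
      have h := hrec (n + 1)
      push_cast at h
      have : (0 : ℝ) ≤ n + 1 - a := by
        have : (0 : ℝ) ≤ n := by positivity
        linarith
      have : (0 : ℝ) < n + 1 + 1 := by positivity
      by_contra! hcon
      nlinarith
  refine ⟨PowerSeries.mk fun n => -c (n + 1), fun n => by simpa using hc n, ?_⟩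
  have hb : (1 - PowerSeries.X * PowerSeries.mk fun n => -c (n + 1)) =
      PowerSeries.rescale (-1 : ℝ) (PowerSeries.binomialSeries ℝ a) := by
    ext n
    cases n with
    | zero => simp
    | succ n =>
      rw [map_sub, PowerSeries.coeff_succ_X_mul]
      simp [c, PowerSeries.coeff_one]
  have hp (j : ℕ) : PowerSeries.binomialSeries ℝ a ^ j =
      PowerSeries.binomialSeries ℝ (j * a) := by
    induction j with
    | zero => simp
    | succ j ih => rw [pow_succ, ih, ← PowerSeries.binomialSeries_add]; push_cast; ring_nf
  rw [hb, ← map_pow, hp, show ((k + 1 : ℕ) : ℝ) * a = (k : ℕ) by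
    simp only [a]; push_cast; field_simp, PowerSeries.binomialSeries_nat]
  simp [sub_eq_add_neg]

/-- The geometric mean `g` of a sequence `b` of series that decreases with respect to `S` and has
inverses in `S` satisfies `b 0 - g ∈ S`. -/
theorem exists_pow_eq_prod [Algebra ℝ R] {S : Subsemiring R}
    (hS : ∀ c : ℝ, 0 ≤ c → ∀ s ∈ S, c • s ∈ S) (k : ℕ) (b : ℕ → PowerSeries R)
    (h1 : ∀ i, PowerSeries.constantCoeff (b i) = 1)
    (hinv : ∀ i, PowerSeries.invOfUnit (b i) 1 ∈ S.powerSeries)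
    (hb : ∀ i, b i - b (i + 1) ∈ S.powerSeries) :
    ∃ g : PowerSeries R, PowerSeries.constantCoeff g = 1 ∧
      g ^ (k + 1) = ∏ i ∈ Finset.range (k + 1), b i ∧ b 0 - g ∈ S.powerSeries := by
  induction k generalizing b with
  | zero => exact ⟨b 0, h1 0, by simp, by simp⟩
  | succ k ih =>
    obtain ⟨g, hg1, hgp, hgb⟩ := ih (fun i => b (i + 1)) (fun i => h1 _) (fun i => hinv _)
      (fun i => hb _)
    obtain ⟨h, hh, hp⟩ := exists_one_sub_X_mul_pow_eq (k + 1)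
    set u := PowerSeries.invOfUnit (b 0) 1
    have hu : b 0 * u = 1 := PowerSeries.mul_invOfUnit _ 1 (by simpa using h1 0)
    have hd : b 0 - g ∈ S.powerSeries := by
      simpa using add_mem (hb 0) hgb
    set s := (b 0 - g) * u
    have hs0 : PowerSeries.constantCoeff s = 0 := by simp [s, h1, hg1]
    have hsub := PowerSeries.HasSubst.of_constantCoeff_zero' hs0
    have hps : (1 - s * h.subst s) ^ (k + 2) = (1 - s) ^ (k + 1) := by
      have := congrArg (PowerSeries.substAlgHom (R := ℝ) hsub) hp
      simp only [map_pow, map_sub, map_one, map_mul, PowerSeries.substAlgHom_X] at this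
      rwa [PowerSeries.coe_substAlgHom] at this
    refine ⟨b 0 * (1 - s * h.subst s), by simp [h1, hs0], ?_, ?_⟩
    · rw [mul_pow, hps, Finset.prod_range_succ', ← hgp]
      have : b 0 * (1 - s) = g := by
        simp only [s]
        linear_combination (g - b 0) * hu
      rw [← this, mul_pow]
      ring
    · have : b 0 - b 0 * (1 - s * h.subst s) = (b 0 - g) * h.subst s := by
        simp only [s]
        linear_combination (b 0 - g) * h.subst ((b 0 - g) * u) * hu
      rw [this]
      exact mul_mem hd (S.subst_mem_powerSeries hS hh hs0 (mul_mem hd (hinv 0)))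

end NonnegSeries

section Determinants

variable {R : Type*} [CommRing R]

theorem det_Xmat_of_recurrence (y w : ℕ → R) (h0 : w 0 = 1)
    (hw : ∀ i, ((i + 1 : ℕ) : R) * w (i + 1) =
      -∑ j ∈ Finset.range (i + 1), y (i - j + 1) * w j) (m : ℕ) :
    (Xmat R m y).det = (-1) ^ m * (m.factorial : R) * w m := by
  cases m with
  | zero => simp [h0]
  | succ m =>
    have hmul (i : Fin (m + 1)) : (Xmat R (m + 1) y *ᵥ fun j => w j) i =
        if i = Fin.last m then -(((m + 1 : ℕ) : R) * w (m + 1)) else 0 := by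
      have hsplit : (Xmat R (m + 1) y *ᵥ fun j => w j) i =
          ∑ j ∈ Finset.range (m + 1), (if j ≤ (i : ℕ) then y ((i : ℕ) - j + 1) * w j else 0) +
          ∑ j ∈ Finset.range (m + 1), (if j = (i : ℕ) + 1 then ((i + 1 : ℕ) : R) * w j else 0) := by
        rw [← Finset.sum_add_distrib, Finset.sum_range, Matrix.mulVec, dotProduct]
        refine Finset.sum_congr rfl fun j _ => ?_
        simp only [Xmat]
        split_ifs <;> first | omega | simp
      have hlow : ∑ j ∈ Finset.range (m + 1), (if j ≤ (i : ℕ) then y ((i : ℕ) - j + 1) * w j else 0) =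
          -(((i + 1 : ℕ) : R) * w (i + 1)) := by
        have hfilter : (Finset.range (m + 1)).filter (· ≤ (i : ℕ)) = Finset.range (i + 1) := by
          ext j
          simp only [Finset.mem_filter, Finset.mem_range]
          omega
        rw [hw, neg_neg, ← Finset.sum_filter, hfilter]
      rw [hsplit, hlow, Finset.sum_ite_eq']
      split_ifs with h1 h2 h2
      · simp [h2] at h1
      · simp
      · simp [h2]
      · simp [Fin.ext_iff] at h1 h2
        omega
    have hdet : (Xmat R (m + 1) y).det =
        ((Xmat R (m + 1) y).updateCol 0 (Xmat R (m + 1) y *ᵥ fun j => w j)).det := by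
      have : (Xmat R (m + 1) y *ᵥ fun j => w j) =
          fun k => ∑ i : Fin (m + 1), w i • Xmat R (m + 1) y k i := by
        ext k
        simp [Matrix.mulVec, dotProduct, mul_comm]
      rw [this, Matrix.det_updateCol_sum]
      simp [h0]
    rw [hdet, Matrix.det_succ_column_zero, Finset.sum_eq_single (Fin.last m)]
    · have htri : (((Xmat R (m + 1) y).updateCol 0
          (Xmat R (m + 1) y *ᵥ fun j => w j)).submatrix
            (Fin.last m).succAbove Fin.succ).det = (m.factorial : R) := by
        rw [Matrix.det_of_isLowerTriangular]
        · rw [← Finset.prod_range_add_one_eq_factorial, Finset.prod_range, Nat.cast_prod]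
          refine Finset.prod_congr rfl fun i _ => ?_
          simp [Xmat, Fin.succAbove_last]
        · intro i j hij
          have hij : (i : ℕ) < j := hij
          rw [Matrix.submatrix_apply, Matrix.updateCol_ne (Fin.succ_ne_zero j)]
          simp only [Xmat, Fin.succAbove_last, Fin.val_succ, Fin.val_castSucc]
          rw [if_neg (by omega), if_neg (by omega)]
      rw [htri, Matrix.updateCol_self, hmul, if_pos rfl, Nat.factorial_succ]
      simp only [Fin.val_last]
      push_cast
      ring
    · intro i _ hi
      rw [Matrix.updateCol_self, hmul, if_neg hi]
      simp
    · simp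

theorem Derivation.leibniz_prod {A : Type*} [CommRing A] [Algebra R A] {ι : Type*} [DecidableEq ι]
    (δ : Derivation R A A) (s : Finset ι) (f : ι → A) :
    δ (∏ i ∈ s, f i) = ∑ i ∈ s, (∏ j ∈ s.erase i, f j) * δ (f i) := by
  induction s using Finset.induction_on with
  | empty => simp
  | insert a s ha ih =>
    rw [Finset.prod_insert ha, δ.leibniz, ih, Finset.sum_insert ha, Finset.erase_insert ha,
      smul_eq_mul, smul_eq_mul, Finset.mul_sum, add_comm]
    congr 1
    refine Finset.sum_congr rfl fun i hi => ?_
    have hia : a ≠ i := fun h => ha (h ▸ hi)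
    rw [Finset.erase_insert_of_ne hia, Finset.prod_insert (by simp [ha]), mul_assoc]

/-- Jacobi's formula. -/
theorem Derivation.det_eq_trace {A : Type*} [CommRing A] [Algebra R A] {ι : Type*} [Fintype ι]
    [DecidableEq ι] (δ : Derivation R A A) (M : Matrix ι ι A) :
    δ M.det = (M.adjugate * M.map δ).trace := by
  have h1 : δ M.det = ∑ i, (M.updateCol i fun j => δ (M j i)).det := by
    simp only [Matrix.det_apply, map_sum]
    rw [Finset.sum_comm]
    refine Finset.sum_congr rfl fun σ _ => ?_
    rw [Units.smul_def, map_zsmul, Derivation.leibniz_prod, Finset.smul_sum]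
    refine Finset.sum_congr rfl fun i _ => ?_
    congr 1
    rw [← Finset.mul_prod_erase _ _ (Finset.mem_univ i), mul_comm, Matrix.updateCol_self]
    congr 1
    refine Finset.prod_congr rfl fun j hj => ?_
    rw [Matrix.updateCol_ne (Finset.ne_of_mem_erase hj)]
  rw [h1, Matrix.trace]
  refine Finset.sum_congr rfl fun i _ => ?_
  rw [← Matrix.cramer_apply, Matrix.cramer_eq_adjugate_mulVec]
  rfl

/-- Logarithmic derivative of the reverse characteristic polynomial. -/
theorem derivative_det_one_sub_X_smul {ι : Type*} [Fintype ι] [DecidableEq ι] (M : Matrix ι ι R) :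
    PowerSeries.derivative R
        (1 - (PowerSeries.X : PowerSeries R) • M.map (PowerSeries.C (R := R))).det =
      -((1 - (PowerSeries.X : PowerSeries R) • M.map (PowerSeries.C (R := R))).det *
        PowerSeries.mk fun k => (M ^ (k + 1)).trace) := by
  set N : Matrix ι ι (PowerSeries R) :=
      1 - (PowerSeries.X : PowerSeries R) • M.map (PowerSeries.C (R := R))
  set K : Matrix ι ι (PowerSeries R) := Matrix.of fun i j => PowerSeries.mk fun k => (M ^ k) i j
  have hKM (k : ℕ) (i j : ι) : PowerSeries.coeff k ((K * M.map PowerSeries.C) i j) =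
      (M ^ (k + 1)) i j := by
    rw [pow_succ, Matrix.mul_apply, Matrix.mul_apply, map_sum]
    simp [K, PowerSeries.coeff_mul_C]
  have hKN : K * N = 1 := by
    simp only [N, mul_sub, mul_one, mul_smul_comm]
    ext i j k
    cases k with
    | zero =>
      simp [K, Matrix.one_apply]
    | succ k =>
      rw [Matrix.sub_apply, map_sub, Matrix.smul_apply, smul_eq_mul, PowerSeries.coeff_succ_X_mul,
        hKM]
      simp [K, Matrix.one_apply]
      split_ifs <;> simp [PowerSeries.coeff_one]
  have hadj : N.adjugate = N.det • K := by
    calc N.adjugate = K * N * N.adjugate := by rw [hKN, one_mul]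
      _ = N.det • K := by rw [mul_assoc, Matrix.mul_adjugate]; simp
  have hder : N.map (PowerSeries.derivative R) = -M.map PowerSeries.C := by
    ext1 i j
    simp [N, Matrix.one_apply]
    split_ifs <;> simp
  rw [Derivation.det_eq_trace, hadj, hder]
  simp only [mul_neg, Matrix.trace_neg, smul_mul_assoc, Matrix.trace_smul, smul_eq_mul]
  congr 2
  ext k
  simp [Matrix.trace, hKM]

theorem det_Xmat_scaled [IsDomain R] (x : ℕ → R) (n : ℕ) :
    (Xmat (PowerSeries R) n fun k =>
        PowerSeries.X ^ k * PowerSeries.C (x k) - if k = 1 then 1 else 0).det =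
      (-1) ^ n *
        (1 - (PowerSeries.X : PowerSeries R) • (Xmat R n x).map (PowerSeries.C (R := R))).det := by
  set Y := Xmat (PowerSeries R) n fun k =>
        PowerSeries.X ^ k * PowerSeries.C (x k) - if k = 1 then 1 else 0
  set N : Matrix (Fin n) (Fin n) (PowerSeries R) :=
      1 -       (PowerSeries.X : PowerSeries R) • (Xmat R n x).map (PowerSeries.C (R := R))
  set E : Matrix (Fin n) (Fin n) (PowerSeries R) := Matrix.diagonal fun i => PowerSeries.X ^ (i : ℕ)
  have hE : E.det ≠ 0 := by
    simp [E, Matrix.det_diagonal, Finset.prod_ne_zero_iff, PowerSeries.X_ne_zero]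
  have hYE : Y * E = E * -N := by
    ext1 i j
    simp only [E, Matrix.mul_diagonal, Matrix.diagonal_mul, Matrix.neg_apply, N, Matrix.sub_apply,
      Matrix.smul_apply, Matrix.map_apply, Y, Xmat, Matrix.one_apply, smul_eq_mul, Fin.ext_iff]
    rcases lt_trichotomy (i : ℕ) j with h | h | h
    · rw [if_neg (not_le.mpr h), if_neg (not_le.mpr h), if_neg h.ne]
      split_ifs with h'
      · rw [h', map_natCast]
        ring
      · simp
    · simp [h]; ring
    · rw [if_pos h.le, if_pos h.le, if_neg (by omega), if_neg (by omega)]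
      obtain ⟨k, hk⟩ := Nat.exists_eq_add_of_le h.le
      simp only [hk, Nat.add_sub_cancel_left]
      ring
  have := congrArg Matrix.det hYE
  rw [Matrix.det_mul, Matrix.det_mul, mul_comm, Matrix.det_neg, Fintype.card_fin] at this
  exact mul_left_cancel₀ hE this

end Determinants

section Ratios

variable {R : Type*} [CommRing R]

/-- The quotients `w (m - k) / w m` of the solution of
`(m + 1) * w (m + 1) = w m - ∑ k ≤ m, y (k + 1) * w (m - k)`, extended by zero to `k > m`. -/
noncomputable def quotientRow (y : ℕ → PowerSeries R) : ℕ → ℕ → PowerSeries R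
  | 0, k => if k = 0 then 1 else 0
  | _ + 1, 0 => 1
  | m + 1, k + 1 =>
    ((m + 1 : ℕ) : PowerSeries R) * PowerSeries.invOfUnit
      (1 - ∑ j ∈ Finset.range (m + 1), y (j + 1) * quotientRow y m j) 1 * quotientRow y m k

/-- The ratio `(m + 1) * w (m + 1) / w m` for `w` as in `quotientRow`. -/
noncomputable def stepRatio (y : ℕ → PowerSeries R) (m : ℕ) : PowerSeries R :=
  1 - ∑ j ∈ Finset.range (m + 1), y (j + 1) * quotientRow y m j

variable {y : ℕ → PowerSeries R}

theorem quotientRow_zero_right (m : ℕ) : quotientRow y m 0 = 1 := by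
  cases m <;> simp [quotientRow]

theorem quotientRow_succ_succ (m k : ℕ) : quotientRow y (m + 1) (k + 1) =
    (m + 1 : ℕ) * PowerSeries.invOfUnit (stepRatio y m) 1 * quotientRow y m k := by
  rw [quotientRow, stepRatio]

theorem constantCoeff_stepRatio (hy : ∀ k, PowerSeries.constantCoeff (y (k + 1)) = 0) (m : ℕ) :
    PowerSeries.constantCoeff (stepRatio y m) = 1 := by
  simp [stepRatio, hy]

theorem stepRatio_mul_invOfUnit (hy : ∀ k, PowerSeries.constantCoeff (y (k + 1)) = 0) (m : ℕ) :
    stepRatio y m * PowerSeries.invOfUnit (stepRatio y m) 1 = 1 :=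
  PowerSeries.mul_invOfUnit _ 1 (by simpa using constantCoeff_stepRatio hy m)

theorem one_sub_stepRatio_mem {S : Subsemiring R} (hS : ∀ k, y (k + 1) ∈ S.powerSeries) {m : ℕ}
    (h : ∀ k, quotientRow y m k ∈ S.powerSeries) : 1 - stepRatio y m ∈ S.powerSeries := by
  rw [stepRatio, sub_sub_cancel]
  exact sum_mem fun j _ => mul_mem (hS j) (h j)

theorem quotientRow_mem {S : Subsemiring R} (hy : ∀ k, PowerSeries.constantCoeff (y (k + 1)) = 0)
    (hS : ∀ k, y (k + 1) ∈ S.powerSeries) (m k : ℕ) : quotientRow y m k ∈ S.powerSeries := by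
  induction m generalizing k with
  | zero =>
    rw [quotientRow]
    split_ifs
    exacts [one_mem _, zero_mem _]
  | succ m ih =>
    cases k with
    | zero => rw [quotientRow_zero_right]; exact one_mem _
    | succ k =>
      rw [quotientRow_succ_succ]
      exact mul_mem (mul_mem (natCast_mem _ _) (Subsemiring.invOfUnit_mem_powerSeries
        (constantCoeff_stepRatio hy m) (one_sub_stepRatio_mem hS ih))) (ih k)

theorem invOfUnit_stepRatio_mem {S : Subsemiring R}
    (hy : ∀ k, PowerSeries.constantCoeff (y (k + 1)) = 0)
    (hS : ∀ k, y (k + 1) ∈ S.powerSeries) (m : ℕ) :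
    PowerSeries.invOfUnit (stepRatio y m) 1 ∈ S.powerSeries :=
  Subsemiring.invOfUnit_mem_powerSeries (constantCoeff_stepRatio hy m)
    (one_sub_stepRatio_mem hS (quotientRow_mem hy hS m))

theorem stepRatio_sub_stepRatio_succ_mem_of_row {S : Subsemiring R}
    (hy : ∀ k, PowerSeries.constantCoeff (y (k + 1)) = 0)
    (hS : ∀ k, y (k + 1) ∈ S.powerSeries) {m : ℕ}
    (h : ∀ k, quotientRow y (m + 1) k - quotientRow y m k ∈ S.powerSeries) :
    stepRatio y m - stepRatio y (m + 1) ∈ S.powerSeries := by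
  have : stepRatio y m - stepRatio y (m + 1) =
      ∑ k ∈ Finset.range (m + 1), y (k + 1) * (quotientRow y (m + 1) k - quotientRow y m k) +
        y (m + 1 + 1) * quotientRow y (m + 1) (m + 1) := by
    simp only [stepRatio, mul_sub, Finset.sum_sub_distrib]
    rw [Finset.sum_range_succ _ (m + 1)]
    ring
  rw [this]
  exact add_mem (sum_mem fun k _ => mul_mem (hS k) (h k))
    (mul_mem (hS _) (quotientRow_mem hy hS _ _))

theorem quotientRow_succ_sub_mem {S : Subsemiring R}
    (hy : ∀ k, PowerSeries.constantCoeff (y (k + 1)) = 0)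
    (hS : ∀ k, y (k + 1) ∈ S.powerSeries) (m k : ℕ) :
    quotientRow y (m + 1) k - quotientRow y m k ∈ S.powerSeries := by
  induction m generalizing k with
  | zero =>
    cases k with
    | zero => simp [quotientRow_zero_right]
    | succ k =>
      have : quotientRow y 0 (k + 1) = 0 := by simp [quotientRow]
      rw [this, sub_zero]
      exact quotientRow_mem hy hS _ _
  | succ m ih =>
    cases k with
    | zero => simp [quotientRow_zero_right]
    | succ k =>
      rw [quotientRow_succ_succ, quotientRow_succ_succ]
      have hd := stepRatio_sub_stepRatio_succ_mem_of_row hy hS ih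
      have hu := stepRatio_mul_invOfUnit hy m
      have hv := stepRatio_mul_invOfUnit hy (m + 1)
      have hum := invOfUnit_stepRatio_mem hy hS m
      have hvm := invOfUnit_stepRatio_mem hy hS (m + 1)
      set u := PowerSeries.invOfUnit (stepRatio y m) 1
      set v := PowerSeries.invOfUnit (stepRatio y (m + 1)) 1
      have hvu : v - u = u * v * (stepRatio y m - stepRatio y (m + 1)) := by
        linear_combination u * hv - v * hu
      have hvum : v - u ∈ S.powerSeries := hvu ▸ mul_mem (mul_mem hum hvm) hd
      have : ((m + 1 + 1 : ℕ) : PowerSeries R) * v * quotientRow y (m + 1) k -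
          ((m + 1 : ℕ) : PowerSeries R) * u * quotientRow y m k =
          v * quotientRow y (m + 1) k + (m + 1 : ℕ) * (v - u) * quotientRow y (m + 1) k +
          (m + 1 : ℕ) * u * (quotientRow y (m + 1) k - quotientRow y m k) := by
        push_cast
        ring
      rw [this]
      have hr := quotientRow_mem hy hS (m + 1) k
      exact add_mem (add_mem (mul_mem hvm hr) (mul_mem (mul_mem (natCast_mem _ _) hvum) hr))
        (mul_mem (mul_mem (natCast_mem _ _) hum) (ih k))

theorem stepRatio_sub_stepRatio_succ_mem {S : Subsemiring R}
    (hy : ∀ k, PowerSeries.constantCoeff (y (k + 1)) = 0)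
    (hS : ∀ k, y (k + 1) ∈ S.powerSeries) (m : ℕ) :
    stepRatio y m - stepRatio y (m + 1) ∈ S.powerSeries :=
  stepRatio_sub_stepRatio_succ_mem_of_row hy hS (quotientRow_succ_sub_mem hy hS m)

theorem det_Xmat_eq_prod_stepRatio [Algebra ℝ R]
    (hy : ∀ k, PowerSeries.constantCoeff (y (k + 1)) = 0) (n : ℕ) :
    (Xmat (PowerSeries R) n fun k => y k - if k = 1 then 1 else 0).det =
      (-1) ^ n * ∏ i ∈ Finset.range n, stepRatio y i := by
  set w : ℕ → PowerSeries R := fun m =>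
    ((m.factorial : ℝ)⁻¹) • ∏ i ∈ Finset.range m, stepRatio y i
  have hfac (m : ℕ) : (m.factorial : PowerSeries R) * w m =
      ∏ i ∈ Finset.range m, stepRatio y i := by
    have : (m.factorial : ℝ) ≠ 0 := by positivity
    rw [← nsmul_eq_mul, ← Nat.cast_smul_eq_nsmul ℝ, smul_inv_smul₀ this]
  have hstep (m : ℕ) : ((m + 1 : ℕ) : PowerSeries R) * w (m + 1) = stepRatio y m * w m := by
    have hm : ((m + 1 : ℕ) : ℝ) ≠ 0 := by positivity
    simp only [w]
    rw [← nsmul_eq_mul, ← Nat.cast_smul_eq_nsmul ℝ, smul_smul, Nat.factorial_succ, Nat.cast_mul,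
      mul_inv, mul_inv_cancel_left₀ hm, Finset.prod_range_succ, mul_smul_comm, mul_comm]
  have hrow (m k : ℕ) (hk : k ≤ m) : w (m - k) = quotientRow y m k * w m := by
    induction m generalizing k with
    | zero =>
      obtain rfl : k = 0 := by omega
      simp [quotientRow]
    | succ m ih =>
      cases k with
      | zero => simp [quotientRow_zero_right]
      | succ k =>
        rw [Nat.add_sub_add_right, ih k (by omega), quotientRow_succ_succ]
        have hu := stepRatio_mul_invOfUnit hy m
        set u := PowerSeries.invOfUnit (stepRatio y m) 1
        linear_combination -(quotientRow y m k * u) * hstep m - quotientRow y m k * w m * hu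
  rw [det_Xmat_of_recurrence _ w (by simp [w]), mul_assoc, hfac]
  intro i
  have hsum : ∑ j ∈ Finset.range (i + 1), y (i - j + 1) * w j =
      ∑ k ∈ Finset.range (i + 1), y (k + 1) * quotientRow y i k * w i := by
    rw [← Finset.sum_range_reflect]
    refine Finset.sum_congr rfl fun k hk => ?_
    have hk : k ≤ i := Nat.lt_succ_iff.mp (Finset.mem_range.mp hk)
    rw [mul_assoc, ← hrow i k hk]
    congr 3
    omega
  have hone : ∑ j ∈ Finset.range (i + 1),
      (if i - j + 1 = 1 then 1 else 0 : PowerSeries R) * w j = w i := by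
    rw [Finset.sum_range_succ, Finset.sum_eq_zero]
    · simp
    · intro j hj
      rw [Finset.mem_range] at hj
      rw [if_neg (by omega), zero_mul]
  simp only [sub_mul, Finset.sum_sub_distrib]
  rw [hstep, hsum, hone, stepRatio, ← Finset.sum_mul]
  ring

end Ratios

/-- Newton's identities for an `(n + 1)`-st root of the reverse characteristic polynomial. -/
theorem det_Xmat_normalized_trace {R : Type*} [CommRing R] [IsDomain R] [Algebra ℝ R] {ι : Type*}
    [Fintype ι] [DecidableEq ι] (M : Matrix ι ι R) (n : ℕ) (g : PowerSeries R)
    (hg1 : PowerSeries.constantCoeff g = 1)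
    (hdet : g ^ (n + 1) =
      (1 - (PowerSeries.X : PowerSeries R) • M.map (PowerSeries.C (R := R))).det) (m : ℕ) :
    (Xmat R m fun k => ((n + 1 : ℕ) : ℝ)⁻¹ • (M ^ k).trace).det =
      (-1) ^ m * (m.factorial : R) * PowerSeries.coeff m g := by
  have hg0 : g ≠ 0 := by
    rintro rfl
    simp at hg1
  have hder : (n + 1) • PowerSeries.derivative R g =
      -(g * PowerSeries.mk fun k => (M ^ (k + 1)).trace) := by
    have h := derivative_det_one_sub_X_smul M
    rw [← hdet, PowerSeries.derivative_pow, Nat.add_sub_cancel] at h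
    refine mul_left_cancel₀ (pow_ne_zero n hg0) ?_
    rw [nsmul_eq_mul]
    linear_combination h
  refine det_Xmat_of_recurrence _ (fun k => PowerSeries.coeff k g) (by simpa using hg1)
    (fun i => ?_) m
  have hn0 : ((n + 1 : ℕ) : ℝ) ≠ 0 := by positivity
  have h := congrArg (PowerSeries.coeff i) hder
  rw [map_nsmul, ← Nat.cast_smul_eq_nsmul ℝ, ← eq_inv_smul_iff₀ hn0, PowerSeries.coeff_derivative,
    map_neg, PowerSeries.coeff_mul, Finset.Nat.sum_antidiagonal_eq_sum_range_succ_mk, smul_neg,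
    Finset.smul_sum] at h
  rw [mul_comm, Nat.cast_succ, h]
  congr 1
  refine Finset.sum_congr rfl fun j _ => ?_
  rw [PowerSeries.coeff_mk, smul_mul_assoc, mul_comm]

/-- The polynomials with nonnegative coefficients. -/
def nonnegCoeffs (σ : Type*) : Subsemiring (MvPolynomial σ ℝ) where
  carrier := {p | ∀ d, 0 ≤ MvPolynomial.coeff d p}
  mul_mem' {p q} hp hq d := by
    classical
    rw [MvPolynomial.coeff_mul]
    exact Finset.sum_nonneg fun e _ => mul_nonneg (hp e.1) (hq e.2)
  one_mem' d := by
    classical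
    rw [MvPolynomial.coeff_one]
    split_ifs <;> simp
  add_mem' hp hq d := by
    rw [MvPolynomial.coeff_add]
    exact add_nonneg (hp d) (hq d)
  zero_mem' d := by simp

theorem stmt19 (n m : ℕ) (hn : 1 ≤ n) (hm : 1 ≤ m) (d : ℕ →₀ ℕ) :
    0 ≤ MvPolynomial.coeff d
      ((-1 : MvPolynomial ℕ ℝ) ^ (m - 1) *
        Matrix.det (Xmat (MvPolynomial ℕ ℝ) m
          (fun k => ((n : ℝ)⁻¹) •
            Matrix.trace ((Xmat (MvPolynomial ℕ ℝ) n MvPolynomial.X) ^ k)))) := by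
  obtain ⟨n, rfl⟩ := Nat.exists_eq_add_of_le' hn
  obtain ⟨m, rfl⟩ := Nat.exists_eq_add_of_le' hm
  set M := Xmat (MvPolynomial ℕ ℝ) (n + 1) MvPolynomial.X
  set y : ℕ → PowerSeries (MvPolynomial ℕ ℝ) := fun k =>
    PowerSeries.X ^ k * PowerSeries.C (MvPolynomial.X k)
  have hy (k : ℕ) : PowerSeries.constantCoeff (y (k + 1)) = 0 := by simp [y]
  have hyS (k : ℕ) : y (k + 1) ∈ (nonnegCoeffs ℕ).powerSeries := by
    intro j e
    classical
    simp only [y, PowerSeries.coeff_X_pow_mul', PowerSeries.coeff_C, MvPolynomial.X]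
    split_ifs <;> simp [MvPolynomial.coeff_monomial]
    split_ifs <;> simp
  have hsmul (c : ℝ) (hc : 0 ≤ c) (p) (hp : p ∈ nonnegCoeffs ℕ) : c • p ∈ nonnegCoeffs ℕ := by
    intro e
    rw [MvPolynomial.coeff_smul]
    exact mul_nonneg hc (hp e)
  obtain ⟨g, hg1, hgp, hgb⟩ := exists_pow_eq_prod hsmul n (stepRatio y)
    (constantCoeff_stepRatio hy) (invOfUnit_stepRatio_mem hy hyS)
    (stepRatio_sub_stepRatio_succ_mem hy hyS)
  have hg : 1 - g ∈ (nonnegCoeffs ℕ).powerSeries := by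
    simpa using add_mem (one_sub_stepRatio_mem hyS (quotientRow_mem hy hyS 0)) hgb
  have hdet : g ^ (n + 1) = (1 - (PowerSeries.X : PowerSeries (MvPolynomial ℕ ℝ)) •
      M.map (PowerSeries.C (R := MvPolynomial ℕ ℝ))).det := by
    have h := det_Xmat_scaled (MvPolynomial.X : ℕ → MvPolynomial ℕ ℝ) (n + 1)
    rw [det_Xmat_eq_prod_stepRatio hy, ← hgp] at h
    exact mul_left_cancel₀ (pow_ne_zero _ (neg_ne_zero.mpr one_ne_zero)) h
  rw [det_Xmat_normalized_trace M n g hg1 hdet]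
  have hcoeff : (-1 : MvPolynomial ℕ ℝ) ^ (m + 1 - 1) * ((-1) ^ (m + 1) *
      ((m + 1).factorial : MvPolynomial ℕ ℝ) * PowerSeries.coeff (m + 1) g) =
      ((m + 1).factorial : MvPolynomial ℕ ℝ) * PowerSeries.coeff (m + 1) (1 - g) := by
    have hsq : (-1 : MvPolynomial ℕ ℝ) ^ m * (-1) ^ m = 1 := by
      rw [← mul_pow]
      simp
    rw [map_sub, PowerSeries.coeff_one, if_neg m.succ_ne_zero, Nat.add_sub_cancel, pow_succ]
    linear_combination -((m + 1).factorial : MvPolynomial ℕ ℝ) * PowerSeries.coeff (m + 1) g * hsq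
  rw [hcoeff]
  exact mul_mem (natCast_mem (nonnegCoeffs ℕ) _) (hg (m + 1)) d
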